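/- arXiv:1111.5451 — 3 statements merged into one kernel-verified Lean document; each statement's English description precedes it below -/
import Mathlib

section
/- Let γ be a complex number with positive imaginary part, let Λ = {m + n·γ : m, n ∈ ℤ}, and set P = {(γ+1)/2 + λ : λ ∈ Λ}. Let Θ : ℂ → ℂ satisfy: (i) Θ is holomorphic on ℂ ∖ P; (ii) Θ(z + 1) = Θ(z) and Θ(z + γ) = Θ(z) for all z ∉ P; (iii) Θ(−z) = Θ(z) for all z ∉ P; (iv) Θ has a pole of order exactly 2 at (γ+1)/2, i.e. the function z ↦ (z − (γ+1)/2)²·Θ(z) extends holomorphically near (γ+1)/2 with a nonzero value at (γ+1)/2; (v) Θ(0) = 0. Set v = Θ(1/2), w = Θ(γ/2), λ = Θ″(1/2)/2 and μ = Θ″(γ/2)/2, and assume v ≠ 0, w ≠ 0 and v ≠ w. Then λ ≠ 0, μ ≠ 0, and λ/v = −μ/w. -/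
open Filter Topology

/-- An analytic function which is even about `e` agrees near `e` with its value at `e` plus a
quadratic term with analytic coefficient. -/
lemma AnalyticAt.exists_eventuallyEq_add_sq_mul_of_even {f : ℂ → ℂ} {e : ℂ}
    (hf : AnalyticAt ℂ f e) (heven : ∀ t, f (e - t) = f (e + t)) :
    ∃ a : ℂ → ℂ, AnalyticAt ℂ a 0 ∧ a 0 = iteratedDeriv 2 f e / 2 ∧
      ∀ᶠ t in 𝓝 0, f (e + t) = f e + t ^ 2 * a t := by
  have hF : AnalyticAt ℂ (fun t ↦ f (e + t)) 0 := by
    refine AnalyticAt.fun_comp (g := f) (by simpa using hf) (by fun_prop)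
  obtain ⟨F, hFa, hFe⟩ := hF.exists_eventuallyEq_sum_add_pow_mul 3
  have h1 : iteratedDeriv 1 f e = 0 := by
    have h := congrFun (iteratedDeriv_comp_const_sub 1 f e) 0
    have h' := congrFun (iteratedDeriv_comp_const_add 1 f e) 0
    rw [funext heven, h'] at h
    simp only [add_zero, sub_zero, pow_one, neg_smul, one_smul] at h
    exact self_eq_neg.mp h
  refine ⟨fun t ↦ iteratedDeriv 2 f e / 2 + t * F t, by fun_prop, by simp, ?_⟩
  filter_upwards [hFe] with t ht
  rw [ht]
  simp only [Finset.sum_range_succ, Finset.sum_range_zero, iteratedDeriv_comp_const_add, add_zero,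
    h1, iteratedDeriv_zero, smul_eq_mul, Nat.factorial]
  push_cast
  ring

namespace PeriodPair

variable (L : PeriodPair)

/-- A doubly periodic function with only removable singularities is constant. -/
lemma exists_const_of_removable {G : ℂ → ℂ} (hper : ∀ z, ∀ l ∈ L.lattice, G (z + l) = G z)
    (hG : ∀ z, ∃ h : ℂ → ℂ, AnalyticAt ℂ h z ∧ G =ᶠ[𝓝[≠] z] h) :
    ∃ K : ℂ, ∀ (z : ℂ) (h : ℂ → ℂ), AnalyticAt ℂ h z → G =ᶠ[𝓝[≠] z] h → h z = K := by
  have hval (z : ℂ) (h : ℂ → ℂ) (hh : AnalyticAt ℂ h z) (hGh : G =ᶠ[𝓝[≠] z] h) :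
      limUnder (𝓝[≠] z) G = h z :=
    ((hh.continuousAt.tendsto.mono_left nhdsWithin_le_nhds).congr' hGh.symm).limUnder_eq
  set F : ℂ → ℂ := fun z ↦ limUnder (𝓝[≠] z) G
  have hF : Differentiable ℂ F := by
    intro z
    obtain ⟨h, hh, hGh⟩ := hG z
    refine (hh.congr ?_).differentiableAt
    have hev := eventually_eventually_nhdsWithin.mpr hGh
    rw [eventually_nhdsWithin_iff] at hev
    filter_upwards [hev, hh.eventually_analyticAt] with x hx hxa
    by_cases hxz : x = z
    · subst hxz
      exact (hval x h hh hGh).symm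
    · refine (hval x h hxa ?_).symm
      have := hx hxz
      rw [nhdsWithin_eq_nhds.mpr (isOpen_compl_singleton.mem_nhds hxz)] at this
      exact this.filter_mono nhdsWithin_le_nhds
  have hFper (z w : ℂ) (hw : w ∈ L.lattice) : F (z + w) = F z := by
    obtain ⟨h, hh, hGh⟩ := hG z
    have hsub : Tendsto (fun x : ℂ ↦ x - w) (𝓝[≠] (z + w)) (𝓝[≠] z) := by
      refine tendsto_nhdsWithin_iff.mpr ⟨?_, ?_⟩
      · exact (Continuous.tendsto' (by fun_prop) _ _ (by ring)).mono_left nhdsWithin_le_nhds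
      · filter_upwards [self_mem_nhdsWithin] with x hx
        simpa [sub_eq_iff_eq_add] using hx
    refine (hval (z + w) (fun x ↦ h (x - w)) ?_ ?_).trans ?_
    · exact AnalyticAt.fun_comp (g := h) (by simpa using hh) (by fun_prop)
    · filter_upwards [hsub.eventually hGh] with x hx
      rw [← hx, ← hper (x - w) w hw, sub_add_cancel]
    · simpa using (hval z h hh hGh).symm
  refine ⟨F 0, fun z h hh hGh ↦ ?_⟩
  rw [← hval z h hh hGh]
  exact hF.apply_eq_apply_of_bounded (IsZLattice.isCompact_range_of_periodic L.lattice F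
    hF.continuous hFper).isBounded z 0

/-- For an even elliptic function `f` with at most a double pole at the half-period `p` (modulo
periods), and another half-period `e`, the product of `f - f e` with its translate by `p - e` is
constant. The constant is expressed through the leading coefficients at `p` and `e`. -/
lemma mul_translate_eq_of_even {f g : ℂ → ℂ} {p e : ℂ}
    (hper : ∀ z, ∀ l ∈ L.lattice, f (z + l) = f z) (heven : ∀ z, f (-z) = f z)
    (hf : ∀ z, z - p ∉ L.lattice → AnalyticAt ℂ f z)
    (hp : 2 * p ∈ L.lattice) (he : 2 * e ∈ L.lattice) (hep : e - p ∉ L.lattice)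
    (hg : AnalyticAt ℂ g p) (hgf : ∀ᶠ z in 𝓝[≠] p, g z = (z - p) ^ 2 * f z)
    {z : ℂ} (hzp : z - p ∉ L.lattice) (hze : z - e ∉ L.lattice) :
    (f z - f e) * (f (z + (p - e)) - f e) = iteratedDeriv 2 f e / 2 * g p := by
  obtain ⟨a, ha, ha0, hfa⟩ := (hf e hep).exists_eventuallyEq_add_sq_mul_of_even fun t ↦ by
    rw [← heven, ← hper _ _ he]
    congr 1
    ring
  set s := p - e with hs
  set G : ℂ → ℂ := fun z ↦ (f z - f e) * (f (z + s) - f e) with hGdef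
  have hs2 : 2 * s ∈ L.lattice := by
    rw [hs, mul_sub]
    exact sub_mem hp he
  have hGper (z : ℂ) (l : ℂ) (hl : l ∈ L.lattice) : G (z + l) = G z := by
    simp only [hGdef, hper z l hl, add_right_comm z l s, hper (z + s) l hl]
  have hGs (z : ℂ) : G (z + s) = G z := by
    simp only [hGdef, add_assoc z s s, ← two_mul, hper z _ hs2]
    ring
  have hGreg (x : ℂ) (hxp : x - p ∉ L.lattice) (hxe : x - e ∉ L.lattice) : AnalyticAt ℂ G x := by
    have h1 := hf x hxp
    have h2 : AnalyticAt ℂ (fun z ↦ f (z + s)) x :=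
      AnalyticAt.fun_comp (g := f) (hf _ (by rwa [hs, show x + (p - e) - p = x - e by ring]))
        (by fun_prop)
    exact (h1.sub analyticAt_const).mul (h2.sub analyticAt_const)
  set h₀ : ℂ → ℂ := fun x ↦ a (x - p) * (g x - f e * (x - p) ^ 2) with hh₀def
  have hh₀ : AnalyticAt ℂ h₀ p := by
    have : AnalyticAt ℂ (fun x ↦ a (x - p)) p :=
      AnalyticAt.fun_comp (g := a) (by simpa using ha) (by fun_prop)
    exact this.mul (hg.sub (by fun_prop))
  have hGh₀ : G =ᶠ[𝓝[≠] p] h₀ := by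
    have ht : Tendsto (fun x : ℂ ↦ x - p) (𝓝[≠] p) (𝓝 0) :=
      (Continuous.tendsto' (by fun_prop) _ _ (by ring)).mono_left nhdsWithin_le_nhds
    filter_upwards [hgf, ht.eventually hfa] with x hx hxa
    have : f (x + s) = f (e + (x - p)) := by
      rw [← hper (e + (x - p)) _ hs2]
      congr 1
      rw [hs]
      ring
    simp only [hGdef, hh₀def, this, hxa, hx]
    ring
  have hshift (x t : ℂ) (hGt : ∀ y, G (y + t) = G y)
      (hx : ∃ h : ℂ → ℂ, AnalyticAt ℂ h (x + t) ∧ G =ᶠ[𝓝[≠] (x + t)] h) :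
      ∃ h : ℂ → ℂ, AnalyticAt ℂ h x ∧ G =ᶠ[𝓝[≠] x] h := by
    obtain ⟨h, hh, hGh⟩ := hx
    refine ⟨fun y ↦ h (y + t), AnalyticAt.fun_comp (g := h) hh (by fun_prop), ?_⟩
    have ht : Tendsto (fun y : ℂ ↦ y + t) (𝓝[≠] x) (𝓝[≠] (x + t)) := by
      refine tendsto_nhdsWithin_iff.mpr ⟨?_, ?_⟩
      · exact (Continuous.tendsto' (by fun_prop) _ _ rfl).mono_left nhdsWithin_le_nhds
      · filter_upwards [self_mem_nhdsWithin] with y hy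
        simpa using hy
    filter_upwards [ht.eventually hGh] with y hy
    rw [← hy, hGt]
  have hpole (x : ℂ) (hx : x - p ∈ L.lattice) :
      ∃ h : ℂ → ℂ, AnalyticAt ℂ h x ∧ G =ᶠ[𝓝[≠] x] h := by
    refine hshift x (-(x - p)) (fun y ↦ hGper y _ (neg_mem hx)) ?_
    rw [show x + -(x - p) = p by ring]
    exact ⟨h₀, hh₀, hGh₀⟩
  obtain ⟨K, hK⟩ := L.exists_const_of_removable hGper fun x ↦ by
    by_cases hxp : x - p ∈ L.lattice
    · exact hpole x hxp
    by_cases hxe : x - e ∈ L.lattice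
    · exact hshift x s hGs (hpole _ (by rwa [hs, show x + (p - e) - p = x - e by ring]))
    · exact ⟨G, hGreg x hxp hxe, EventuallyEq.rfl⟩
  have h1 := hK z G (hGreg z hzp hze) EventuallyEq.rfl
  have h2 := hK p h₀ hh₀ hGh₀
  simp only [hh₀def, sub_self, ha0] at h2
  simp only [hGdef] at h1
  rw [h1, ← h2]
  ring

end PeriodPair

/-- The pair of periods `1, γ` for `γ` in the upper half-plane. -/
def PeriodPair.ofUpperHalfPlane (γ : ℂ) (hγ : 0 < γ.im) : PeriodPair where
  ω₁ := 1
  ω₂ := γ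
  indep := by
    refine LinearIndependent.pair_iff.mpr fun s t h ↦ ?_
    have him := congrArg Complex.im h
    have hre := congrArg Complex.re h
    simp only [Complex.add_im, Complex.smul_im, Complex.one_im, Complex.zero_im, smul_eq_mul,
      mul_zero, zero_add, mul_eq_zero, hγ.ne', or_false] at him
    simpa [him] using hre

/-- Lemma 1 of the paper: for an even `Λ`-periodic function `Θ`, holomorphic off the
translates `P = (γ+1)/2 + Λ` of its unique (double) pole, normalized by `Θ(0) = 0`, the
leading coefficients `λ = Θ″(1/2)/2` and `μ = Θ″(γ/2)/2` of the expansions of `Θ` at the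
half-periods `1/2` and `γ/2` satisfy `λ ≠ 0`, `μ ≠ 0` and `λ/v = −μ/w`, where
`v = Θ(1/2)` and `w = Θ(γ/2)`. -/
theorem lattes_theta_coefficients (γ : ℂ) (hγ : 0 < γ.im) (Θ : ℂ → ℂ) (P : Set ℂ)
    (hP : P = {z : ℂ | ∃ m n : ℤ, z = (γ + 1) / 2 + ((m : ℂ) + (n : ℂ) * γ)})
    (hol : ∀ z ∉ P, DifferentiableAt ℂ Θ z)
    (per1 : ∀ z ∉ P, Θ (z + 1) = Θ z)
    (per2 : ∀ z ∉ P, Θ (z + γ) = Θ z)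
    (heven : ∀ z ∉ P, Θ (-z) = Θ z)
    (hpole : ∃ g : ℂ → ℂ, AnalyticAt ℂ g ((γ + 1) / 2) ∧ g ((γ + 1) / 2) ≠ 0 ∧
      ∀ᶠ z in 𝓝[≠] ((γ + 1) / 2), g z = (z - (γ + 1) / 2) ^ 2 * Θ z)
    (h0 : Θ 0 = 0)
    (v w lam mu : ℂ)
    (hv : v = Θ (1 / 2)) (hw : w = Θ (γ / 2))
    (hlam : lam = iteratedDeriv 2 Θ (1 / 2) / 2)
    (hmu : mu = iteratedDeriv 2 Θ (γ / 2) / 2)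
    (hv0 : v ≠ 0) (hw0 : w ≠ 0) (hvw : v ≠ w) :
    lam ≠ 0 ∧ mu ≠ 0 ∧ lam / v = -(mu / w) := by
  classical
  obtain ⟨g, hg, hg0, hgΘ⟩ := hpole
  set p := (γ + 1) / 2 with hp
  set L := PeriodPair.ofUpperHalfPlane γ hγ
  have h1L : (1 : ℂ) ∈ L.lattice := L.ω₁_mem_lattice
  have hγL : γ ∈ L.lattice := L.ω₂_mem_lattice
  have h1L' : (1 / 2 : ℂ) ∉ L.lattice := L.ω₁_div_two_notMem_lattice
  have hγL' : γ / 2 ∉ L.lattice := L.ω₂_div_two_notMem_lattice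
  have hpL' : p ∉ L.lattice := by
    have := (L.mul_ω₁_add_mul_ω₂_mem_lattice (α := 1 / 2) (β := 1 / 2)).not.mpr (by norm_num)
    convert! this using 2
    change (γ + 1) / 2 = ((1 / 2 : ℚ) : ℂ) * 1 + ((1 / 2 : ℚ) : ℂ) * γ
    push_cast
    ring
  have hpL : 2 * p ∈ L.lattice := by
    rw [hp, show 2 * ((γ + 1) / 2) = γ + 1 by ring]
    exact add_mem hγL h1L
  have hPL (z : ℂ) : z ∈ P ↔ z - p ∈ L.lattice := by
    rw [hP, PeriodPair.mem_lattice]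
    refine exists₂_congr fun m n ↦ ?_
    change z = p + (m + n * γ) ↔ m * 1 + n * γ = z - p
    constructor <;> intro h <;> linear_combination -h
  have hPadd (z l : ℂ) (hl : l ∈ L.lattice) : z + l ∈ P ↔ z ∈ P := by
    rw [hPL, hPL, add_sub_right_comm]
    exact L.lattice.add_mem_iff_left hl
  have hPneg (z : ℂ) : -z ∈ P ↔ z ∈ P := by
    rw [hPL, hPL, ← neg_mem_iff, ← L.lattice.add_mem_iff_left (neg_mem hpL)]
    ring_nf
  have hPclosed : IsClosed P := by
    have : P = (fun z ↦ z - p) ⁻¹' L.lattice := Set.ext hPL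
    rw [this]
    exact L.isClosed_lattice.preimage (by fun_prop)
  set f : ℂ → ℂ := fun z ↦ if z ∈ P then 0 else Θ z with hfdef
  have hfΘ (z : ℂ) (hz : z ∉ P) : f z = Θ z := if_neg hz
  have hfΘ' (z : ℂ) (hz : z ∉ P) : f =ᶠ[𝓝 z] Θ := by
    filter_upwards [hPclosed.isOpen_compl.mem_nhds hz] with x hx using hfΘ x hx
  have hf1 : Function.Periodic f 1 := fun z ↦ by
    simp only [hfdef, hPadd z 1 h1L]
    split_ifs with hz
    exacts [rfl, per1 z hz]
  have hfγ : Function.Periodic f γ := fun z ↦ by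
    simp only [hfdef, hPadd z γ hγL]
    split_ifs with hz
    exacts [rfl, per2 z hz]
  have hfper (z l : ℂ) (hl : l ∈ L.lattice) : f (z + l) = f z := by
    obtain ⟨m, n, rfl⟩ := PeriodPair.mem_lattice.mp hl
    change f (z + (m * 1 + n * γ)) = f z
    rw [← add_assoc, hfγ.int_mul n, hf1.int_mul m]
  have hfeven (z : ℂ) : f (-z) = f z := by
    simp only [hfdef, hPneg z]
    split_ifs with hz
    exacts [rfl, heven z hz]
  have hfan (z : ℂ) (hz : z - p ∉ L.lattice) : AnalyticAt ℂ f z := by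
    rw [← hPL] at hz
    refine AnalyticAt.congr ?_ (hfΘ' z hz).symm
    exact DifferentiableOn.analyticAt (s := Pᶜ)
      (fun x hx ↦ (hol x hx).differentiableWithinAt) (hPclosed.isOpen_compl.mem_nhds hz)
  have hgf : ∀ᶠ z in 𝓝[≠] p, g z = (z - p) ^ 2 * f z := by
    have hnear : ∀ᶠ z in 𝓝 p, z - p ∈ ((L.lattice : Set ℂ) \ {0})ᶜ :=
      (Continuous.tendsto' (by fun_prop) p 0 (by ring)).eventually
        (L.compl_lattice_sdiff_singleton_mem_nhds 0)
    filter_upwards [hgΘ, hnear.filter_mono nhdsWithin_le_nhds, self_mem_nhdsWithin]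
      with z hz hzL hzp
    rw [hz, hfΘ z fun hzP ↦ hzL ⟨(hPL z).mp hzP, sub_ne_zero.mpr hzp⟩]
  have h1p : (1 / 2 : ℂ) - p ∉ L.lattice := by
    rwa [← neg_mem_iff, hp, show -(1 / 2 - (γ + 1) / 2) = γ / 2 by ring]
  have hγp : γ / 2 - p ∉ L.lattice := by
    rwa [← neg_mem_iff, hp, show -(γ / 2 - (γ + 1) / 2) = 1 / 2 by ring]
  have h0p : (0 : ℂ) - p ∉ L.lattice := by rwa [zero_sub, neg_mem_iff]
  have h1P := (hPL _).not.mpr h1p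
  have hγP := (hPL _).not.mpr hγp
  have hf0 : f 0 = 0 := (hfΘ 0 ((hPL _).not.mpr h0p)).trans h0
  have hfv : f (1 / 2) = v := (hfΘ _ h1P).trans hv.symm
  have hfw : f (γ / 2) = w := (hfΘ _ hγP).trans hw.symm
  have key₁ := L.mul_translate_eq_of_even hfper hfeven hfan hpL (by simpa using h1L) h1p hg hgf
    h0p (by rwa [zero_sub, neg_mem_iff])
  have key₂ := L.mul_translate_eq_of_even hfper hfeven hfan hpL
    (by rwa [mul_div_cancel₀ γ two_ne_zero]) hγp hg hgf h0p (by rwa [zero_sub, neg_mem_iff])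
  rw [(hfΘ' _ h1P).iteratedDeriv_eq 2, ← hlam, show 0 + (p - 1 / 2) = γ / 2 by rw [hp]; ring,
    hf0, hfv, hfw] at key₁
  rw [(hfΘ' _ hγP).iteratedDeriv_eq 2, ← hmu, show 0 + (p - γ / 2) = 1 / 2 by rw [hp]; ring,
    hf0, hfv, hfw] at key₂
  have hvw' : v - w ≠ 0 := sub_ne_zero.mpr hvw
  refine ⟨?_, ?_, ?_⟩
  · rintro rfl
    refine mul_ne_zero hv0 hvw' ?_
    linear_combination key₁
  · rintro rfl
    refine mul_ne_zero hw0 hvw' ?_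
    linear_combination -key₂
  · have hlin : lam * w + mu * v = 0 := by
      refine (mul_eq_zero.mp ?_).resolve_right hg0
      linear_combination -w * key₁ - v * key₂
    field_simp
    linear_combination hlin
end

section
/- Let F : ℂ × ℂ → ℂ be holomorphic (complex analytic) on a neighborhood of (0, x₀) and on a neighborhood of (0, y₀), where x₀, y₀ ∈ ℂ with x₀ ≠ y₀, and suppose F(0, x₀) = y₀, F(0, y₀) = x₀, and (∂F/∂z)(0, x₀)·(∂F/∂z)(0, y₀) ≠ 1 (here ∂F/∂z denotes the partial derivative in the second variable). Then there exist ε > 0 and holomorphic functions x, y on the disc {t : |t| < ε} with x(0) = x₀, y(0) = y₀, F(t, x(t)) = y(t) and F(t, y(t)) = x(t) for all |t| < ε, and moreover x′(0) = ( (∂F/∂t)(0, y₀) + (∂F/∂z)(0, y₀)·(∂F/∂t)(0, x₀) ) / ( 1 − (∂F/∂z)(0, x₀)·(∂F/∂z)(0, y₀) ). -/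
open Metric

open Filter Topology

/-- The partial derivative in the second variable in terms of the total derivative. -/
lemma HasFDerivAt.deriv_prodMk_left {𝕜 E : Type*} [NontriviallyNormedField 𝕜]
    [NormedAddCommGroup E] [NormedSpace 𝕜 E] {f : 𝕜 × 𝕜 → E} {f' : 𝕜 × 𝕜 →L[𝕜] E} {s z : 𝕜}
    (hf : HasFDerivAt f f' (s, z)) : deriv (fun w => f (s, w)) z = f' (0, 1) :=
  (hf.comp_hasDerivAt z ((hasDerivAt_const z s).prodMk (hasDerivAt_id z))).deriv

/-- The partial derivative in the first variable in terms of the total derivative. -/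
lemma HasFDerivAt.deriv_prodMk_right {𝕜 E : Type*} [NontriviallyNormedField 𝕜]
    [NormedAddCommGroup E] [NormedSpace 𝕜 E] {f : 𝕜 × 𝕜 → E} {f' : 𝕜 × 𝕜 →L[𝕜] E} {s z : 𝕜}
    (hf : HasFDerivAt f f' (s, z)) : deriv (fun t => f (t, z)) s = f' (1, 0) :=
  (hf.comp_hasDerivAt s ((hasDerivAt_id s).prodMk (hasDerivAt_const s z))).deriv

/-- The chain rule along a graph `t ↦ (t, u t)`, in terms of partial derivatives. -/
lemma hasDerivAt_comp_graph {𝕜 : Type*} [NontriviallyNormedField 𝕜]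
    {f : 𝕜 × 𝕜 → 𝕜} {u : 𝕜 → 𝕜} {u' s : 𝕜}
    (hu : HasDerivAt u u' s) (hf : DifferentiableAt 𝕜 f (s, u s)) :
    HasDerivAt (fun t => f (t, u t))
      (deriv (fun t => f (t, u s)) s + deriv (fun z => f (s, z)) (u s) * u') s := by
  have hf' := hf.hasFDerivAt
  rw [hf'.deriv_prodMk_left, hf'.deriv_prodMk_right]
  refine (hf'.comp_hasDerivAt s ((hasDerivAt_id s).prodMk hu)).congr_deriv ?_
  have h : ((1, u') : 𝕜 × 𝕜) = (1, 0) + u' • (0, 1) := by simp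
  rw [h, map_add, map_smul, smul_eq_mul, mul_comm]

/-- The analytic implicit function theorem for a scalar equation in one scalar unknown. -/
lemma AnalyticAt.exists_implicit {𝕜 : Type*} [RCLike 𝕜] {G : 𝕜 × 𝕜 → 𝕜} {s z : 𝕜}
    (hG : AnalyticAt 𝕜 G (s, z)) (h : deriv (fun w => G (s, w)) z ≠ 0) :
    ∃ u : 𝕜 → 𝕜, AnalyticAt 𝕜 u s ∧ u s = z ∧ ∀ᶠ t in 𝓝 s, G (t, u t) = G (s, z) := by
  have hinv : (fderiv 𝕜 G (s, z) ∘L .inr 𝕜 𝕜 𝕜).IsInvertible := by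
    rw [hG.differentiableAt.hasFDerivAt.deriv_prodMk_left] at h
    refine ⟨ContinuousLinearEquiv.unitsEquivAut 𝕜 (Units.mk0 _ h), ?_⟩
    ext
    simp
  have hc : ContDiffAt 𝕜 ⊤ G (s, z) := hG.contDiffAt
  have hn : (⊤ : WithTop ℕ∞) ≠ 0 := by simp
  exact ⟨hc.implicitFunction hn hinv, (hc.contDiffAt_implicitFunction hn hinv).analyticAt,
    hc.implicitFunction_apply_self hn hinv, hc.eventually_apply_implicitFunction hn hinv⟩

/-- Persistence of a period-2 cycle with multiplier `≠ 1` in a holomorphic family: if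
`F(0, x₀) = y₀`, `F(0, y₀) = x₀` with `x₀ ≠ y₀` and
`(∂F/∂z)(0,x₀)·(∂F/∂z)(0,y₀) ≠ 1`, then there are holomorphic `x(t), y(t)` on a disc
around `0` with `x(0) = x₀`, `y(0) = y₀`, `F(t,x(t)) = y(t)`, `F(t,y(t)) = x(t)` and
`x′(0) = ((∂F/∂t)(0,y₀) + (∂F/∂z)(0,y₀)·(∂F/∂t)(0,x₀)) / (1 − (∂F/∂z)(0,x₀)·(∂F/∂z)(0,y₀))`. -/
theorem holomorphic_two_cycle_persistence (x₀ y₀ : ℂ) (hxy : x₀ ≠ y₀) (F : ℂ × ℂ → ℂ)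
    (hFx : AnalyticAt ℂ F (0, x₀)) (hFy : AnalyticAt ℂ F (0, y₀))
    (hswap₁ : F (0, x₀) = y₀) (hswap₂ : F (0, y₀) = x₀)
    (hmult : deriv (fun z : ℂ => F (0, z)) x₀ * deriv (fun z : ℂ => F (0, z)) y₀ ≠ 1) :
    ∃ ε > 0, ∃ x y : ℂ → ℂ, AnalyticOnNhd ℂ x (ball (0 : ℂ) ε) ∧
      AnalyticOnNhd ℂ y (ball (0 : ℂ) ε) ∧ x 0 = x₀ ∧ y 0 = y₀ ∧
      (∀ t ∈ ball (0 : ℂ) ε, F (t, x t) = y t ∧ F (t, y t) = x t) ∧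
      deriv x 0 =
        (deriv (fun t : ℂ => F (t, y₀)) 0 +
            deriv (fun z : ℂ => F (0, z)) y₀ * deriv (fun t : ℂ => F (t, x₀)) 0) /
          (1 - deriv (fun z : ℂ => F (0, z)) x₀ * deriv (fun z : ℂ => F (0, z)) y₀) := by
  have hFy' : AnalyticAt ℂ F (0, F (0, x₀)) := by rwa [hswap₁]
  have hG : AnalyticAt ℂ (fun p : ℂ × ℂ => F (p.1, F p) - p.2) (0, x₀) :=
    (hFy'.comp₂ analyticAt_fst hFx).sub analyticAt_snd
  have hne : deriv (fun w => F (0, F (0, w)) - w) x₀ ≠ 0 := by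
    have hx : DifferentiableAt ℂ (fun z => F (0, z)) x₀ :=
      hFx.differentiableAt.comp x₀ (by fun_prop)
    have hy : DifferentiableAt ℂ (fun z => F (0, z)) (F (0, x₀)) :=
      hFy'.differentiableAt.comp (F (0, x₀)) (by fun_prop)
    have hd := (hy.hasDerivAt.comp x₀ hx.hasDerivAt).sub (hasDerivAt_id x₀)
    refine hd.deriv.trans_ne ?_
    rwa [hswap₁, sub_ne_zero, mul_comm]
  obtain ⟨x, hx, hx0, hxG⟩ := hG.exists_implicit hne
  simp only [hswap₁, hswap₂, sub_self, sub_eq_zero] at hxG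
  have hFx' : AnalyticAt ℂ F (0, x 0) := by rwa [hx0]
  have hy : AnalyticAt ℂ (fun t => F (t, x t)) 0 := hFx'.comp₂ analyticAt_id hx
  obtain ⟨ε, hε, hball⟩ := Metric.eventually_nhds_iff_ball.1
    ((hx.eventually_analyticAt.and hy.eventually_analyticAt).and hxG)
  refine ⟨ε, hε, x, fun t => F (t, x t), fun t ht => (hball t ht).1.1,
    fun t ht => (hball t ht).1.2, hx0, by simp [hx0, hswap₁], fun t ht => ⟨rfl, (hball t ht).2⟩, ?_⟩
  have hdy := hasDerivAt_comp_graph hx.differentiableAt.hasDerivAt hFx'.differentiableAt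
  have hdx := hasDerivAt_comp_graph (f := F) hdy (by rw [hx0, hswap₁]; exact hFy.differentiableAt)
  have key := hdx.deriv.symm.trans (EventuallyEq.deriv_eq hxG)
  simp only [hx0, hswap₁] at key
  rw [eq_div_iff (sub_ne_zero.2 hmult.symm)]
  linear_combination -key
end

section
/- Let U ⊆ ℂ be open, let A, B : U → ℂ be holomorphic with B(γ) ≠ 0 for all γ ∈ U, and define F : U × ℂ → ℂ by F(γ, u) = A(γ) + u·B(γ). Let F_k : U × ℂ → ℂ (k ∈ ℕ) be holomorphic functions converging to F locally uniformly on U × ℂ. Then for every open set Γ whose closure is a compact subset of U, there exists k₀ ∈ ℕ such that for every k ≥ k₀ there is a holomorphic function u_k : Γ → ℂ with F_k(γ, u_k(γ)) = 0 for all γ ∈ Γ, and the functions u_k (k ≥ k₀) converge uniformly on Γ to the function γ ↦ −A(γ)/B(γ). -/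
open Filter Topology

/-- A holomorphic family of self-maps of a disc with values in the disc of radius `1 / 2`
has a holomorphic family of fixed points. -/
theorem exists_differentiableOn_fixedPoint {Γ : Set ℂ} (hΓ : IsOpen Γ) {H : ℂ × ℂ → ℂ}
    (hH : DifferentiableOn ℂ H (Γ ×ˢ Metric.ball 0 2))
    (hbound : ∀ γ ∈ Γ, ∀ w ∈ Metric.ball (0 : ℂ) 2, ‖H (γ, w)‖ ≤ 1 / 2) :
    ∃ w : ℂ → ℂ, DifferentiableOn ℂ w Γ ∧
      ∀ γ ∈ Γ, ‖w γ‖ ≤ 1 / 2 ∧ H (γ, w γ) = w γ := by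
  have hslice : ∀ γ ∈ Γ, DifferentiableOn ℂ (fun w => H (γ, w)) (Metric.ball 0 2) := by
    intro γ hγ
    exact hH.comp (by fun_prop) fun w hw => ⟨hγ, hw⟩
  have hlip : ∀ γ ∈ Γ, ∀ x ∈ Metric.closedBall (0 : ℂ) (1 / 2),
      ∀ y ∈ Metric.closedBall (0 : ℂ) (1 / 2),
        ‖H (γ, y) - H (γ, x)‖ ≤ 1 / 2 * ‖y - x‖ := by
    intro γ hγ x hx y hy
    refine (convex_closedBall (0 : ℂ) (1 / 2)).norm_image_sub_le_of_norm_deriv_le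
      (f := fun w => H (γ, w)) ?_ ?_ hx hy
    · intro z hz
      exact (hslice γ hγ).differentiableAt
        (Metric.isOpen_ball.mem_nhds (Metric.closedBall_subset_ball (by norm_num) hz))
    · intro z hz
      have hsub : Metric.closedBall z 1 ⊆ Metric.ball 0 2 :=
        Metric.closedBall_subset_ball' (by
          have := Metric.mem_closedBall.1 hz
          linarith)
      have := Complex.norm_deriv_le_of_forall_mem_sphere_norm_le (c := z) one_pos
        (((hslice γ hγ).mono hsub).diffContOnCl_ball subset_rfl)
        (fun w hw => hbound γ hγ w (hsub (Metric.sphere_subset_closedBall hw)))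
      simpa using this
  let v : ℕ → ℂ → ℂ := fun n => n.rec (fun _ => 0) fun _ f γ => H (γ, f γ)
  have hv_succ : ∀ n γ, v (n + 1) γ = H (γ, v n γ) := fun _ _ => rfl
  have hball : Metric.closedBall (0 : ℂ) (1 / 2) ⊆ Metric.ball 0 2 :=
    Metric.closedBall_subset_ball (by norm_num)
  have hv_mem : ∀ n, ∀ γ ∈ Γ, v n γ ∈ Metric.closedBall (0 : ℂ) (1 / 2) := by
    intro n γ hγ
    induction n with
    | zero => simp [v]
    | succ n ih =>
      rw [mem_closedBall_zero_iff, hv_succ]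
      exact hbound γ hγ _ (hball ih)
  have hv_diff : ∀ n, DifferentiableOn ℂ (v n) Γ := by
    intro n
    induction n with
    | zero => exact differentiableOn_const 0
    | succ n ih =>
      exact hH.comp (differentiableOn_id.prodMk ih) fun γ hγ => ⟨hγ, hball (hv_mem n γ hγ)⟩
  have hv_dist : ∀ γ ∈ Γ, ∀ n, dist (v n γ) (v (n + 1) γ) ≤ 1 / 2 * (1 / 2) ^ n := by
    intro γ hγ n
    induction n with
    | zero =>
      have := mem_closedBall_zero_iff.1 (hv_mem 1 γ hγ)
      simpa [v, dist_eq_norm] using this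
    | succ n ih =>
      rw [dist_comm, dist_eq_norm] at ih ⊢
      calc ‖v (n + 1 + 1) γ - v (n + 1) γ‖
          ≤ 1 / 2 * ‖v (n + 1) γ - v n γ‖ :=
            hlip γ hγ _ (hv_mem n γ hγ) _ (hv_mem (n + 1) γ hγ)
        _ ≤ 1 / 2 * (1 / 2 * (1 / 2) ^ n) := by gcongr
        _ = 1 / 2 * (1 / 2) ^ (n + 1) := by ring
  have hlim : ∀ γ, ∃ l, γ ∈ Γ → Tendsto (fun n => v n γ) atTop (𝓝 l) := by
    intro γ
    by_cases hγ : γ ∈ Γ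
    · obtain ⟨l, hl⟩ := cauchySeq_tendsto_of_complete
        (cauchySeq_of_le_geometric (1 / 2) (1 / 2) (by norm_num) (hv_dist γ hγ))
      exact ⟨l, fun _ => hl⟩
    · exact ⟨0, fun h => absurd h hγ⟩
  choose w hw using hlim
  have hunif : TendstoUniformlyOn v w atTop Γ := by
    have hgeom : Tendsto (fun n : ℕ => (1 / 2 : ℝ) * (1 / 2) ^ n / (1 - 1 / 2)) atTop (𝓝 0) := by
      have := tendsto_pow_atTop_nhds_zero_of_lt_one (r := (1 / 2 : ℝ)) (by norm_num) (by norm_num)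
      simpa using (this.const_mul (1 / 2 : ℝ)).div_const (1 - 1 / 2)
    rw [Metric.tendstoUniformlyOn_iff]
    intro ε hε
    filter_upwards [hgeom.eventually_lt_const hε] with n hn γ hγ
    rw [dist_comm]
    exact (dist_le_of_le_geometric_of_tendsto (1 / 2) (1 / 2) (by norm_num) (hv_dist γ hγ)
      (hw γ hγ) n).trans_lt hn
  refine ⟨w, hunif.tendstoLocallyUniformlyOn.differentiableOn
    (Eventually.of_forall hv_diff) hΓ, fun γ hγ => ?_⟩
  have hw_mem : w γ ∈ Metric.closedBall (0 : ℂ) (1 / 2) :=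
    Metric.isClosed_closedBall.mem_of_tendsto (hw γ hγ)
      (Eventually.of_forall fun n => hv_mem n γ hγ)
  refine ⟨mem_closedBall_zero_iff.1 hw_mem, ?_⟩
  have hcont : ContinuousAt (fun z => H (γ, z)) (w γ) :=
    ((hslice γ hγ).differentiableAt (Metric.isOpen_ball.mem_nhds (hball hw_mem))).continuousAt
  exact tendsto_nhds_unique (hcont.tendsto.comp (hw γ hγ))
    ((tendsto_add_atTop_iff_nat 1).2 (hw γ hγ))

/-- Parametric zero-selection lemma: if holomorphic functions `F_k` on `U × ℂ` converge
locally uniformly to `F(γ, u) = A(γ) + u·B(γ)` with `A, B` holomorphic on `U` and `B`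
nonvanishing, then on any open `Γ` with compact closure contained in `U`, for all large
`k` there are holomorphic functions `u_k : Γ → ℂ` solving `F_k(γ, u_k(γ)) = 0` and
converging uniformly on `Γ` to `γ ↦ −A(γ)/B(γ)`. -/
theorem parametric_zero_selection (U : Set ℂ) (hU : IsOpen U) (A B : ℂ → ℂ)
    (hA : DifferentiableOn ℂ A U) (hB : DifferentiableOn ℂ B U)
    (hB0 : ∀ γ ∈ U, B γ ≠ 0) (F : ℂ × ℂ → ℂ)
    (hF : ∀ p : ℂ × ℂ, F p = A p.1 + p.2 * B p.1)
    (Fk : ℕ → ℂ × ℂ → ℂ)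
    (hFk : ∀ k : ℕ, DifferentiableOn ℂ (Fk k) (U ×ˢ (Set.univ : Set ℂ)))
    (hconv : TendstoLocallyUniformlyOn Fk F atTop (U ×ˢ (Set.univ : Set ℂ))) :
    ∀ Γ : Set ℂ, IsOpen Γ → IsCompact (closure Γ) → closure Γ ⊆ U →
      ∃ k₀ : ℕ, ∃ u : ℕ → ℂ → ℂ,
        (∀ k ≥ k₀, DifferentiableOn ℂ (u k) Γ ∧ ∀ γ ∈ Γ, Fk k (γ, u k γ) = 0) ∧
        TendstoUniformlyOn u (fun γ : ℂ => -A γ / B γ) atTop Γ := by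
  intro Γ hΓ hcpt hsub
  have hΓU : Γ ⊆ U := subset_closure.trans hsub
  have hroot : DifferentiableOn ℂ (fun γ => -A γ / B γ) U := hA.neg.div hB hB0
  let φ : ℂ × ℂ → ℂ × ℂ := fun p => (p.1, -A p.1 / B p.1 + p.2)
  have hφ : DifferentiableOn ℂ φ (U ×ˢ Set.univ) :=
    differentiableOn_fst.prodMk
      ((hroot.comp differentiableOn_fst fun p hp => hp.1).add differentiableOn_snd)
  have hφ_maps : Set.MapsTo φ (U ×ˢ Set.univ) (U ×ˢ Set.univ) := fun p hp => ⟨hp.1, trivial⟩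
  let H : ℕ → ℂ × ℂ → ℂ := fun k p => p.2 - Fk k (φ p) * (B p.1)⁻¹
  have hB_inv : DifferentiableOn ℂ (fun p : ℂ × ℂ => (B p.1)⁻¹) (U ×ˢ Set.univ) :=
    (hB.inv hB0).comp differentiableOn_fst fun p hp => hp.1
  have hH : ∀ k, DifferentiableOn ℂ (H k) (U ×ˢ Set.univ) := fun k =>
    differentiableOn_snd.sub (((hFk k).comp hφ hφ_maps).mul hB_inv)
  have hH_eq : ∀ k, ∀ p : ℂ × ℂ, p.1 ∈ U → H k p = (F (φ p) - Fk k (φ p)) * (B p.1)⁻¹ := by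
    intro k p hp
    have := hB0 p.1 hp
    simp only [H, hF, φ]
    field_simp
    ring
  obtain ⟨C, hC⟩ := hcpt.exists_bound_of_continuousOn
    ((hB.continuousOn.mono hsub).inv₀ fun γ hγ => hB0 γ (hsub hγ))
  let K : Set (ℂ × ℂ) := closure Γ ×ˢ Metric.closedBall 0 2
  have hKU : K ⊆ U ×ˢ Set.univ := Set.prod_mono hsub (Set.subset_univ _)
  have hK : IsCompact (φ '' K) :=
    (hcpt.prod (isCompact_closedBall _ _)).image_of_continuousOn (hφ.continuousOn.mono hKU)
  have hunif : TendstoUniformlyOn Fk F atTop (φ '' K) :=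
    (tendstoLocallyUniformlyOn_iff_forall_isCompact (hU.prod isOpen_univ)).1 hconv _
      ((hφ_maps.mono_left hKU).image_subset) hK
  have hsmall : ∀ ε > 0, ∀ᶠ k in atTop, ∀ γ ∈ Γ, ∀ w ∈ Metric.ball (0 : ℂ) 2,
      ‖H k (γ, w)‖ ≤ ε := by
    intro ε hε
    have hδ : 0 < ε / (|C| + 1) := by positivity
    filter_upwards [Metric.tendstoUniformlyOn_iff.1 hunif _ hδ] with k hk γ hγ w hw
    have hF_le := (hk (φ (γ, w)) (Set.mem_image_of_mem φ
      (show (γ, w) ∈ K from ⟨subset_closure hγ, Metric.ball_subset_closedBall hw⟩))).le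
    rw [dist_eq_norm] at hF_le
    have hB_le : ‖(B γ)⁻¹‖ ≤ |C| + 1 :=
      (hC γ (subset_closure hγ)).trans ((le_abs_self C).trans (by linarith))
    rw [hH_eq k _ (hΓU hγ), norm_mul]
    calc _ ≤ ε / (|C| + 1) * (|C| + 1) := by gcongr
      _ = ε := by field_simp
  obtain ⟨k₀, hk₀⟩ := eventually_atTop.1 (hsmall (1 / 2) (by norm_num))
  have hfix : ∀ k, ∃ w : ℂ → ℂ, k₀ ≤ k → DifferentiableOn ℂ w Γ ∧
      ∀ γ ∈ Γ, ‖w γ‖ ≤ 1 / 2 ∧ H k (γ, w γ) = w γ := by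
    intro k
    by_cases hk : k₀ ≤ k
    · obtain ⟨w, hw⟩ := exists_differentiableOn_fixedPoint hΓ
        ((hH k).mono (Set.prod_mono hΓU (Set.subset_univ _))) (hk₀ k hk)
      exact ⟨w, fun _ => hw⟩
    · exact ⟨0, fun h => absurd h hk⟩
  choose w hw using hfix
  refine ⟨k₀, fun k γ => -A γ / B γ + w k γ, fun k hk => ⟨?_, fun γ hγ => ?_⟩, ?_⟩
  · exact (hroot.mono hΓU).add (hw k hk).1
  · have h := ((hw k hk).2 γ hγ).2
    simpa [H, φ, hB0 γ (hΓU hγ)] using h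
  · rw [Metric.tendstoUniformlyOn_iff]
    intro ε hε
    filter_upwards [hsmall (ε / 2) (half_pos hε), eventually_ge_atTop k₀] with k hk hkk₀ γ hγ
    obtain ⟨hle, heq⟩ := (hw k hkk₀).2 γ hγ
    have hwε := hk γ hγ (w k γ) (mem_ball_zero_iff.2 (by linarith))
    rw [heq] at hwε
    rw [dist_self_add_right]
    linarith
end
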